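/- Fix an integer d ≥ 1 and s > 0. For all polynomials p and q in d variables with complex coefficients, ∫_{ℝ^d} conj((e^{−sΔ/2}p)(x)) · (e^{−sΔ/2}q)(x) dP_s(x) = Σ_{n=0}^∞ (sⁿ/n!) Σ_{k_1,…,k_n ∈ {1,…,d}} conj((∂_{k_1}⋯∂_{k_n} p)(0)) · (∂_{k_1}⋯∂_{k_n} q)(0), where the outer sum has only finitely many nonzero terms (those with n at most the degrees of p and q). -/

import Mathlib

open MeasureTheory

noncomputable section

/-- The Gaussian density `P_s(x) = (2πs)^{-d/2} exp(-|x|²/(2s))` on `ℝ^d`. -/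
def gaussDensity (d : ℕ) (s : ℝ) (x : Fin d → ℝ) : ℝ :=
  (2 * Real.pi * s) ^ (-(d : ℝ) / 2) * Real.exp (-(∑ i, x i ^ 2) / (2 * s))

/-- The Gaussian measure `P_s` on `ℝ^d`. -/
def gaussMeasure (d : ℕ) (s : ℝ) : Measure (Fin d → ℝ) :=
  volume.withDensity fun x => ENNReal.ofReal (gaussDensity d s x)

/-- The analytic continuation `P_t(z) = (2πt)^{-d/2} exp(-(z₁² + ⋯ + z_d²)/(2t))` of the
Gaussian density to `ℂ^d`. -/
def heatKernelC (d : ℕ) (t : ℝ) (z : Fin d → ℂ) : ℂ :=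
  (((2 * Real.pi * t) ^ (-(d : ℝ) / 2) : ℝ) : ℂ) * Complex.exp (-(∑ i, z i ^ 2) / (2 * t))

/-- The inclusion of `ℝ^d` into `ℂ^d`. -/
def coeRC (d : ℕ) (x : Fin d → ℝ) : Fin d → ℂ := fun i => (x i : ℂ)

/-- The Laplacian `Δ = Σ_j ∂²/∂x_j²` acting on polynomials. -/
def mvLaplacian (d : ℕ) (p : MvPolynomial (Fin d) ℂ) : MvPolynomial (Fin d) ℂ :=
  ∑ j : Fin d, MvPolynomial.pderiv j (MvPolynomial.pderiv j p)

/-- The heat operator `e^{cΔ/2}` on polynomials, given by the finite sum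
`Σ_k (c/2)^k Δ^k p / k!` (which terminates since `Δ^k p = 0` once `2k` exceeds the degree). -/
def heatOp (d : ℕ) (c : ℝ) (p : MvPolynomial (Fin d) ℂ) : MvPolynomial (Fin d) ℂ :=
  ∑ k ∈ Finset.range (p.totalDegree + 1),
    (((c : ℂ) / 2) ^ k / (Nat.factorial k : ℂ)) • (mvLaplacian d)^[k] p

/-- Evaluation of a complex polynomial at a real point of `ℝ^d`. -/
def evalR (d : ℕ) (p : MvPolynomial (Fin d) ℂ) (x : Fin d → ℝ) : ℂ :=
  MvPolynomial.eval (fun i => (x i : ℂ)) p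

/-- The iterated partial derivative `∂_{k₁} ⋯ ∂_{k_n}` of a polynomial, along a tuple
`k : Fin n → Fin d` of coordinate directions. -/
def tupleDeriv (d : ℕ) {n : ℕ} (k : Fin n → Fin d) (p : MvPolynomial (Fin d) ℂ) :
    MvPolynomial (Fin d) ℂ :=
  (List.ofFn k).foldl (fun q i => MvPolynomial.pderiv i q) p

section Gaussian

open ProbabilityTheory

lemma gaussDensity_eq_prod (d : ℕ) {s : ℝ} (hs : 0 < s) (x : Fin d → ℝ) :
    gaussDensity d s x = ∏ i, gaussianPDFReal 0 s.toNNReal (x i) := by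
  have h2 : 0 < 2 * Real.pi * s := by positivity
  simp only [gaussDensity, gaussianPDFReal, Real.coe_toNNReal s hs.le, sub_zero]
  rw [Finset.prod_mul_distrib, ← Real.exp_sum, Finset.prod_const, Finset.card_univ,
    Fintype.card_fin, ← Finset.sum_div, Finset.sum_neg_distrib, Real.sqrt_eq_rpow,
    ← Real.rpow_neg h2.le, ← Real.rpow_natCast, ← Real.rpow_mul h2.le]
  congr 2
  ring

lemma integrable_gaussianPDFReal_mul_pow {s : ℝ} (hs : 0 < s) (n : ℕ) :
    Integrable fun x : ℝ => gaussianPDFReal 0 s.toNNReal x * x ^ n := by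
  have h := (integrable_rpow_mul_exp_neg_mul_sq (b := (2 * s)⁻¹) (by positivity)
    (s := n) (by linarith [n.cast_nonneg (α := ℝ)])).const_mul (√(2 * Real.pi * s))⁻¹
  refine h.congr (Filter.Eventually.of_forall fun x => ?_)
  simp only [gaussianPDFReal, Real.coe_toNNReal s hs.le, sub_zero, Real.rpow_natCast]
  rw [show -(2 * s)⁻¹ * x ^ 2 = -x ^ 2 / (2 * s) by ring]
  ring

lemma hasDerivAt_gaussianPDFReal {s : ℝ} (hs : 0 < s) (x : ℝ) :
    HasDerivAt (gaussianPDFReal 0 s.toNNReal)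
      (-(x / s) * gaussianPDFReal 0 s.toNNReal x) x := by
  simp only [gaussianPDFReal_def, Real.coe_toNNReal s hs.le, sub_zero]
  have h : HasDerivAt (fun y : ℝ => -y ^ 2 / (2 * s)) (-(x / s)) x := by
    convert! ((hasDerivAt_pow 2 x).neg).div_const (2 * s) using 1
    field_simp
    simp [mul_comm]
  convert! (h.exp.const_mul (√(2 * Real.pi * s))⁻¹) using 1
  ring

lemma integral_gaussianPDFReal_mul_pow_succ {s : ℝ} (hs : 0 < s) (n : ℕ) :
    ∫ x : ℝ, gaussianPDFReal 0 s.toNNReal x * x ^ (n + 1)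
      = s * (n * ∫ x : ℝ, gaussianPDFReal 0 s.toNNReal x * x ^ (n - 1)) := by
  have hd : ∀ x : ℝ, HasDerivAt (fun y => gaussianPDFReal 0 s.toNNReal y * y ^ n)
      (n * (gaussianPDFReal 0 s.toNNReal x * x ^ (n - 1))
        - s⁻¹ * (gaussianPDFReal 0 s.toNNReal x * x ^ (n + 1))) x := fun x => by
    convert! (hasDerivAt_gaussianPDFReal hs x).mul (hasDerivAt_pow n x) using 1
    ring
  have h1 := (integrable_gaussianPDFReal_mul_pow hs (n - 1)).const_mul (n : ℝ)
  have h2 := (integrable_gaussianPDFReal_mul_pow hs (n + 1)).const_mul s⁻¹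
  have h := integral_eq_zero_of_hasDerivAt_of_integrable hd (h1.sub h2)
    (integrable_gaussianPDFReal_mul_pow hs n)
  rw [integral_sub h1 h2, integral_const_mul, integral_const_mul, sub_eq_zero] at h
  rw [h, mul_inv_cancel_left₀ hs.ne']

lemma evalR_monomial (d : ℕ) (a : Fin d →₀ ℕ) (c : ℂ) (x : Fin d → ℝ) :
    evalR d (MvPolynomial.monomial a c) x = c * ∏ i, (x i : ℂ) ^ a i := by
  rw [evalR, MvPolynomial.eval_monomial, Finsupp.prod_fintype _ _ (by simp)]

lemma measurable_gaussDensity (d : ℕ) (s : ℝ) : Measurable (gaussDensity d s) := by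
  unfold gaussDensity
  fun_prop

lemma gaussDensity_nonneg (d : ℕ) {s : ℝ} (hs : 0 < s) (x : Fin d → ℝ) :
    0 ≤ gaussDensity d s x := by
  unfold gaussDensity
  positivity

lemma gaussDensity_smul_evalR_monomial (d : ℕ) {s : ℝ} (hs : 0 < s) (a : Fin d →₀ ℕ) (c : ℂ)
    (x : Fin d → ℝ) :
    (ENNReal.ofReal (gaussDensity d s x)).toReal • evalR d (MvPolynomial.monomial a c) x
      = c * ∏ i, ((gaussianPDFReal 0 s.toNNReal (x i) * x i ^ a i : ℝ) : ℂ) := by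
  rw [ENNReal.toReal_ofReal (gaussDensity_nonneg d hs x), gaussDensity_eq_prod d hs,
    evalR_monomial, Complex.real_smul]
  push_cast
  rw [Finset.prod_mul_distrib]
  ring

lemma integrable_evalR (d : ℕ) {s : ℝ} (hs : 0 < s) (p : MvPolynomial (Fin d) ℂ) :
    Integrable (evalR d p) (gaussMeasure d s) := by
  induction p using MvPolynomial.induction_on' with
  | monomial a c =>
    rw [gaussMeasure, integrable_withDensity_iff_integrable_smul'
      (measurable_gaussDensity d s).ennreal_ofReal (by simp)]
    simp only [gaussDensity_smul_evalR_monomial d hs]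
    exact (Integrable.fintype_prod fun i =>
      (integrable_gaussianPDFReal_mul_pow hs (a i)).ofReal).const_mul c
  | add p q hp hq =>
    refine (hp.add hq).congr (Filter.Eventually.of_forall fun x => ?_)
    simp [evalR]

/-- Integration of polynomials against the Gaussian measure, as a linear functional. -/
def gaussExp (d : ℕ) {s : ℝ} (hs : 0 < s) : MvPolynomial (Fin d) ℂ →ₗ[ℂ] ℂ where
  toFun p := ∫ x, evalR d p x ∂gaussMeasure d s
  map_add' p q := by
    rw [← integral_add (integrable_evalR d hs p) (integrable_evalR d hs q)]
    simp [evalR]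
  map_smul' c p := by
    simp [evalR, integral_const_mul]

lemma gaussExp_monomial (d : ℕ) {s : ℝ} (hs : 0 < s) (a : Fin d →₀ ℕ) (c : ℂ) :
    gaussExp d hs (MvPolynomial.monomial a c)
      = c * ∏ i, ((∫ x : ℝ, gaussianPDFReal 0 s.toNNReal x * x ^ a i : ℝ) : ℂ) := by
  change ∫ x, evalR d (MvPolynomial.monomial a c) x ∂gaussMeasure d s = _
  rw [gaussMeasure, integral_withDensity_eq_integral_toReal_smul
    (measurable_gaussDensity d s).ennreal_ofReal (by simp)]
  simp only [gaussDensity_smul_evalR_monomial d hs]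
  rw [integral_const_mul, integral_fintype_prod_volume_eq_prod
    (f := fun i (y : ℝ) => ((gaussianPDFReal 0 s.toNNReal y * y ^ a i : ℝ) : ℂ))]
  simp only [integral_complex_ofReal]

lemma gaussExp_one (d : ℕ) {s : ℝ} (hs : 0 < s) : gaussExp d hs 1 = 1 := by
  have h := gaussExp_monomial d hs 0 1
  have h1 := integral_gaussianPDFReal_eq_one 0 (v := s.toNNReal) (by simpa using hs)
  simpa [h1] using h

/-- Gaussian integration by parts. -/
lemma gaussExp_X_mul (d : ℕ) {s : ℝ} (hs : 0 < s) (j : Fin d) (p : MvPolynomial (Fin d) ℂ) :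
    gaussExp d hs (MvPolynomial.X j * p) = s * gaussExp d hs (MvPolynomial.pderiv j p) := by
  induction p using MvPolynomial.induction_on' with
  | monomial a c =>
    rw [MvPolynomial.X, MvPolynomial.monomial_mul, one_mul, MvPolynomial.pderiv_monomial,
      gaussExp_monomial, gaussExp_monomial]
    simp only [← Finset.mul_prod_erase Finset.univ _ (Finset.mem_univ j)]
    have e : ∀ i ∈ Finset.univ.erase j,
        (Finsupp.single j 1 + a : Fin d →₀ ℕ) i = (a - Finsupp.single j 1 : Fin d →₀ ℕ) i :=
      fun i hi => by simp [Finsupp.single_eq_of_ne (Finset.ne_of_mem_erase hi)]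
    rw [Finset.prod_congr rfl fun i hi => by rw [e i hi]]
    simp only [Finsupp.add_apply, Finsupp.tsub_apply, Finsupp.single_eq_same, add_comm 1,
      integral_gaussianPDFReal_mul_pow_succ hs (a j)]
    push_cast
    ring
  | add p q hp hq => rw [mul_add, map_add, map_add, map_add, hp, hq, mul_add]

end Gaussian

section HeatOperator

open MvPolynomial

lemma pderiv_comm' {d : ℕ} (i j : Fin d) (p : MvPolynomial (Fin d) ℂ) :
    pderiv i (pderiv j p) = pderiv j (pderiv i p) := by
  rcases eq_or_ne i j with rfl | h
  · rfl
  ext m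
  simp only [coeff_pderiv, Finsupp.add_apply, Finsupp.single_eq_of_ne h,
    Finsupp.single_eq_of_ne h.symm, add_right_comm m (Finsupp.single i 1)]
  push_cast
  ring

lemma pderiv_X_mul {d : ℕ} (i j : Fin d) (p : MvPolynomial (Fin d) ℂ) :
    pderiv i (X j * p) = (if i = j then p else 0) + X j * pderiv i p := by
  rw [pderiv_mul]
  rcases eq_or_ne i j with rfl | h
  · simp
  · simp [pderiv_X_of_ne h.symm, h]

/-- The Laplacian as a linear map. -/
def laplacianLin (d : ℕ) : Module.End ℂ (MvPolynomial (Fin d) ℂ) :=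
  ∑ j : Fin d, (pderiv j).toLinearMap ∘ₗ (pderiv j).toLinearMap

lemma laplacianLin_apply (d : ℕ) (p : MvPolynomial (Fin d) ℂ) :
    laplacianLin d p = ∑ j, pderiv j (pderiv j p) := by
  simp [laplacianLin]

lemma iterate_mvLaplacian (d k : ℕ) (p : MvPolynomial (Fin d) ℂ) :
    (mvLaplacian d)^[k] p = (laplacianLin d ^ k) p := by
  rw [Module.End.pow_apply, show mvLaplacian d = laplacianLin d from
    funext fun q => (laplacianLin_apply d q).symm]

lemma laplacianLin_X_mul (d : ℕ) (j : Fin d) (p : MvPolynomial (Fin d) ℂ) :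
    laplacianLin d (X j * p) = X j * laplacianLin d p + (2 : ℂ) • pderiv j p := by
  simp only [laplacianLin_apply, pderiv_X_mul, map_add, apply_ite (pderiv _), map_zero,
    Finset.sum_add_distrib, Finset.sum_ite_eq', Finset.mem_univ, if_true, Finset.mul_sum, two_smul]
  ring

lemma laplacianLin_pow_pderiv (d k : ℕ) (j : Fin d) (p : MvPolynomial (Fin d) ℂ) :
    (laplacianLin d ^ k) (pderiv j p) = pderiv j ((laplacianLin d ^ k) p) := by
  induction k with
  | zero => rfl
  | succ k ih =>
    rw [pow_succ', Module.End.mul_apply, ih, Module.End.mul_apply, laplacianLin_apply,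
      laplacianLin_apply, map_sum]
    exact Finset.sum_congr rfl fun i _ => by rw [pderiv_comm' i j, pderiv_comm' i j]

lemma laplacianLin_pow_succ_X_mul (d k : ℕ) (j : Fin d) (p : MvPolynomial (Fin d) ℂ) :
    (laplacianLin d ^ (k + 1)) (X j * p)
      = X j * (laplacianLin d ^ (k + 1)) p
        + (2 * (k + 1) : ℂ) • pderiv j ((laplacianLin d ^ k) p) := by
  induction k with
  | zero => simp [laplacianLin_X_mul]
  | succ k ih =>
    rw [pow_succ', Module.End.mul_apply, ih, map_add, laplacianLin_X_mul, map_smul,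
      ← pow_one (laplacianLin d), laplacianLin_pow_pderiv, pow_one, ← Module.End.mul_apply,
      ← Module.End.mul_apply, ← pow_succ', ← pow_succ', add_assoc, ← add_smul]
    congr 2
    push_cast
    ring

lemma coeff_laplacianLin_pow_eq_zero (d k n : ℕ) (p : MvPolynomial (Fin d) ℂ)
    (hp : ∀ m : Fin d →₀ ℕ, n + k ≤ m.degree → coeff m p = 0) (m : Fin d →₀ ℕ)
    (hm : n ≤ m.degree) : coeff m ((laplacianLin d ^ k) p) = 0 := by
  induction k generalizing p with
  | zero => exact hp m hm
  | succ k ih =>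
    rw [pow_succ, Module.End.mul_apply]
    refine ih _ fun m' hm' => ?_
    rw [laplacianLin_apply, coeff_sum]
    refine Finset.sum_eq_zero fun j _ => ?_
    rw [coeff_pderiv, coeff_pderiv, hp, zero_mul, zero_mul]
    simp only [map_add, Finsupp.degree_single]
    omega

lemma laplacianLin_pow_eq_zero (d k : ℕ) (p : MvPolynomial (Fin d) ℂ)
    (hk : p.totalDegree < k) : (laplacianLin d ^ k) p = 0 := by
  ext m
  refine coeff_laplacianLin_pow_eq_zero d k 0 p (fun m' hm' => ?_) m (Nat.zero_le _)
  exact coeff_eq_zero_of_totalDegree_lt (by rw [Finsupp.degree_apply] at hm'; omega)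

/-- The truncation of `e^{cΔ/2}` to its first `N` terms. -/
def heatTrunc (d N : ℕ) (c : ℝ) : Module.End ℂ (MvPolynomial (Fin d) ℂ) :=
  ∑ k ∈ Finset.range N, (((c : ℂ) / 2) ^ k / (Nat.factorial k : ℂ)) • laplacianLin d ^ k

lemma heatTrunc_apply (d N : ℕ) (c : ℝ) (p : MvPolynomial (Fin d) ℂ) :
    heatTrunc d N c p = ∑ k ∈ Finset.range N,
      (((c : ℂ) / 2) ^ k / (Nat.factorial k : ℂ)) • (laplacianLin d ^ k) p := by
  simp [heatTrunc]

lemma heatOp_eq_heatTrunc (d : ℕ) (c : ℝ) (p : MvPolynomial (Fin d) ℂ) {N : ℕ}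
    (hN : p.totalDegree < N) : heatOp d c p = heatTrunc d N c p := by
  simp only [heatOp, heatTrunc_apply, iterate_mvLaplacian]
  refine Finset.sum_subset (Finset.range_subset_range.2 hN) fun k _ hk => ?_
  rw [laplacianLin_pow_eq_zero d k p (by simpa [Nat.lt_succ_iff] using hk), smul_zero]

lemma heatOp_add (d : ℕ) (c : ℝ) (p q : MvPolynomial (Fin d) ℂ) :
    heatOp d c (p + q) = heatOp d c p + heatOp d c q := by
  obtain ⟨N, hN⟩ := exists_gt (max (p + q).totalDegree (max p.totalDegree q.totalDegree))
  simp only [max_lt_iff] at hN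
  rw [heatOp_eq_heatTrunc d c _ hN.1, heatOp_eq_heatTrunc d c _ hN.2.1,
    heatOp_eq_heatTrunc d c _ hN.2.2, map_add]

lemma heatOp_C (d : ℕ) (c : ℝ) (a : ℂ) : heatOp d c (C a) = C a := by
  simp [heatOp]

lemma heatOp_pderiv (d : ℕ) (c : ℝ) (j : Fin d) (p : MvPolynomial (Fin d) ℂ) :
    heatOp d c (pderiv j p) = pderiv j (heatOp d c p) := by
  obtain ⟨N, hN⟩ := exists_gt (max (pderiv j p).totalDegree p.totalDegree)
  simp only [max_lt_iff] at hN
  rw [heatOp_eq_heatTrunc d c _ hN.1, heatOp_eq_heatTrunc d c _ hN.2]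
  simp only [heatTrunc_apply, laplacianLin_pow_pderiv, map_sum, Derivation.map_smul]

lemma heatOp_X_mul (d : ℕ) (c : ℝ) (j : Fin d) (p : MvPolynomial (Fin d) ℂ) :
    heatOp d c (X j * p) = X j * heatOp d c p + (c : ℂ) • pderiv j (heatOp d c p) := by
  obtain ⟨N, hN⟩ := exists_gt (max (X j * p).totalDegree p.totalDegree)
  simp only [max_lt_iff] at hN
  rw [heatOp_eq_heatTrunc d c (X j * p) (hN.1.trans N.lt_succ_self)]
  nth_rw 1 [heatOp_eq_heatTrunc d c p (hN.2.trans N.lt_succ_self)]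
  rw [heatOp_eq_heatTrunc d c p hN.2]
  simp only [heatTrunc_apply, Finset.sum_range_succ' _ N, laplacianLin_pow_succ_X_mul, smul_add,
    Finset.sum_add_distrib, mul_add (X j : MvPolynomial (Fin d) ℂ), Finset.mul_sum, map_sum, Derivation.map_smul, Finset.smul_sum,
    smul_smul, mul_smul_comm]
  have h : ∀ k : ℕ, ((c : ℂ) / 2) ^ (k + 1) / (Nat.factorial (k + 1) : ℂ) * (2 * (k + 1))
      = c * (((c : ℂ) / 2) ^ k / (Nat.factorial k : ℂ)) := fun k => by
    have : (Nat.factorial k : ℂ) ≠ 0 := by exact_mod_cast k.factorial_ne_zero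
    have : (k + 1 : ℂ) ≠ 0 := by exact_mod_cast k.succ_ne_zero
    rw [Nat.factorial_succ]
    push_cast
    field_simp
    ring
  simp only [h, pow_zero, Module.End.one_apply]
  abel

end HeatOperator

section Pairings

open MvPolynomial

/-- The `L²` pairing of `e^{-sΔ/2}p` and `e^{-sΔ/2}q`. -/
def hermitePairing (d : ℕ) (s : ℝ) (p q : MvPolynomial (Fin d) ℂ) : ℂ :=
  ∫ x : Fin d → ℝ, (starRingEnd ℂ) (evalR d (heatOp d (-s) p) x) * evalR d (heatOp d (-s) q) x
    ∂(gaussMeasure d s)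

lemma hermitePairing_eq_gaussExp (d : ℕ) {s : ℝ} (hs : 0 < s) (p q : MvPolynomial (Fin d) ℂ) :
    hermitePairing d s p q
      = gaussExp d hs (map (starRingEnd ℂ) (heatOp d (-s) p) * heatOp d (-s) q) := by
  change _ = ∫ x, evalR d _ x ∂gaussMeasure d s
  refine integral_congr_ae (Filter.Eventually.of_forall fun x => ?_)
  simp only [evalR, map_mul, eval_map]
  congr 1
  change (starRingEnd ℂ) (eval₂ (RingHom.id ℂ) _ _) = _
  rw [eval₂_comp_left]
  simp [Function.comp_def]

lemma hermitePairing_X_mul_left (d : ℕ) {s : ℝ} (hs : 0 < s) (j : Fin d)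
    (p q : MvPolynomial (Fin d) ℂ) :
    hermitePairing d s (X j * p) q = s * hermitePairing d s p (pderiv j q) := by
  simp only [hermitePairing_eq_gaussExp d hs, heatOp_X_mul, heatOp_pderiv, map_add, map_mul, map_X,
    smul_eq_C_mul, map_C, ← pderiv_map, add_mul, mul_assoc, gaussExp_X_mul, pderiv_mul]
  simp only [← smul_eq_C_mul, map_smul, smul_eq_mul, Complex.ofReal_neg]
  simp
  ring

lemma hermitePairing_add_left (d : ℕ) {s : ℝ} (hs : 0 < s) (p p' q : MvPolynomial (Fin d) ℂ) :
    hermitePairing d s (p + p') q = hermitePairing d s p q + hermitePairing d s p' q := by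
  simp only [hermitePairing_eq_gaussExp d hs, heatOp_add, map_add, add_mul]

lemma hermitePairing_C_left (d : ℕ) {s : ℝ} (hs : 0 < s) (a : ℂ) (q : MvPolynomial (Fin d) ℂ) :
    hermitePairing d s (C a) q = (starRingEnd ℂ) a * eval 0 q := by
  simp only [hermitePairing_eq_gaussExp d hs, heatOp_C, map_C, ← smul_eq_C_mul, map_smul,
    smul_eq_mul]
  congr 1
  induction q using MvPolynomial.induction_on with
  | C b =>
    rw [heatOp_C, ← mul_one (C b), ← smul_eq_C_mul, map_smul, gaussExp_one]
    simp
  | add p q hp hq => rw [heatOp_add, map_add, map_add, hp, hq]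
  | mul_X p j _ =>
    rw [mul_comm, heatOp_X_mul, map_add, gaussExp_X_mul, map_smul]
    simp

/-- The pairing `Σ_{k₁,…,k_n} conj(∂_{k₁}⋯∂_{k_n}p(0)) ∂_{k₁}⋯∂_{k_n}q(0)`. -/
def derivPairing (d n : ℕ) (p q : MvPolynomial (Fin d) ℂ) : ℂ :=
  ∑ k : Fin n → Fin d, (starRingEnd ℂ) (eval 0 (tupleDeriv d k p)) * eval 0 (tupleDeriv d k q)

lemma derivPairing_zero (d : ℕ) (p q : MvPolynomial (Fin d) ℂ) :
    derivPairing d 0 p q = (starRingEnd ℂ) (eval 0 p) * eval 0 q := by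
  simp [derivPairing, tupleDeriv]

lemma derivPairing_succ (d n : ℕ) (p q : MvPolynomial (Fin d) ℂ) :
    derivPairing d (n + 1) p q = ∑ i, derivPairing d n (pderiv i p) (pderiv i q) := by
  simp only [derivPairing]
  rw [← (Fin.consEquiv fun _ => Fin d).sum_comp, Fintype.sum_prod_type]
  simp [tupleDeriv, Fin.consEquiv, List.ofFn_succ]

lemma derivPairing_add_left (d n : ℕ) (p p' q : MvPolynomial (Fin d) ℂ) :
    derivPairing d n (p + p') q = derivPairing d n p q + derivPairing d n p' q := by
  induction n generalizing p p' q with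
  | zero => simp [derivPairing_zero, add_mul]
  | succ n ih => simp only [derivPairing_succ, map_add, ih, Finset.sum_add_distrib]

lemma derivPairing_zero_left (d n : ℕ) (q : MvPolynomial (Fin d) ℂ) :
    derivPairing d n 0 q = 0 := by
  simpa using derivPairing_add_left d n 0 0 q

lemma derivPairing_succ_C_left (d n : ℕ) (a : ℂ) (q : MvPolynomial (Fin d) ℂ) :
    derivPairing d (n + 1) (C a) q = 0 := by
  simp [derivPairing_succ, derivPairing_zero_left]

lemma derivPairing_succ_X_mul_left (d n : ℕ) (j : Fin d) (p q : MvPolynomial (Fin d) ℂ) :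
    derivPairing d (n + 1) (X j * p) q = (n + 1) * derivPairing d n p (pderiv j q) := by
  have h : ∀ n p q, derivPairing d (n + 1) (X j * p) q
      = derivPairing d n p (pderiv j q)
        + ∑ i, derivPairing d n (X j * pderiv i p) (pderiv i q) := fun n p q => by
    simp only [derivPairing_succ d n, pderiv_X_mul, derivPairing_add_left, Finset.sum_add_distrib]
    congr 1
    rw [Finset.sum_eq_single j (fun i _ hi => by simp [hi, derivPairing_zero_left]) (by simp)]
    simp
  induction n generalizing p q with
  | zero => simp [h, derivPairing_zero]
  | succ n ih =>
    rw [h]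
    simp only [ih, pderiv_comm' j, ← Finset.mul_sum, ← derivPairing_succ]
    push_cast
    ring

lemma exists_derivPairing_eq_zero (d : ℕ) (p : MvPolynomial (Fin d) ℂ) :
    ∃ N, ∀ n ≥ N, ∀ q, derivPairing d n p q = 0 := by
  induction p using MvPolynomial.induction_on with
  | C a =>
    refine ⟨1, fun n hn q => ?_⟩
    obtain ⟨n, rfl⟩ := Nat.exists_eq_add_of_le' hn
    exact derivPairing_succ_C_left d n a q
  | add p q hp hq =>
    obtain ⟨N, hN⟩ := hp
    obtain ⟨M, hM⟩ := hq
    refine ⟨max N M, fun n hn r => ?_⟩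
    rw [derivPairing_add_left, hN n (le_of_max_le_left hn), hM n (le_of_max_le_right hn), add_zero]
  | mul_X p j hp =>
    obtain ⟨N, hN⟩ := hp
    refine ⟨N + 1, fun n hn q => ?_⟩
    obtain ⟨n, rfl⟩ := Nat.exists_eq_add_of_le' (Nat.le_of_add_left_le hn)
    rw [mul_comm, derivPairing_succ_X_mul_left, hN n (by omega), mul_zero]

lemma hasSum_derivPairing (d : ℕ) {s : ℝ} (hs : 0 < s) (p q : MvPolynomial (Fin d) ℂ) :
    HasSum (fun n : ℕ => (s : ℂ) ^ n / (Nat.factorial n : ℂ) * derivPairing d n p q)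
      (hermitePairing d s p q) := by
  induction p using MvPolynomial.induction_on generalizing q with
  | C a =>
    convert hasSum_single 0 fun n hn => ?_ using 1
    · simp [derivPairing_zero, hermitePairing_C_left d hs]
    · obtain ⟨n, rfl⟩ := Nat.exists_eq_succ_of_ne_zero hn
      rw [derivPairing_succ_C_left, mul_zero]
  | add p p' hp hp' =>
    simpa only [derivPairing_add_left, hermitePairing_add_left d hs, mul_add]
      using (hp q).add (hp' q)
  | mul_X p j hp =>
    rw [mul_comm, hermitePairing_X_mul_left d hs, ← hasSum_nat_add_iff' 1]
    convert! (hp (pderiv j q)).mul_left (s : ℂ) using 1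
    · funext n
      have : (Nat.factorial n : ℂ) ≠ 0 := by exact_mod_cast n.factorial_ne_zero
      have : (n + 1 : ℂ) ≠ 0 := by exact_mod_cast n.succ_ne_zero
      rw [derivPairing_succ_X_mul_left, Nat.factorial_succ]
      push_cast
      field_simp
      ring
    · simp [derivPairing_zero]

end Pairings

/-- identity (3.7). For all polynomials `p, q`,
`⟨e^{-sΔ/2}p, e^{-sΔ/2}q⟩_{L²(P_s)} = Σ_n (sⁿ/n!) Σ_{k₁,…,k_n} conj(∂_{k₁}⋯∂_{k_n}p(0)) ·
(∂_{k₁}⋯∂_{k_n}q(0))`, the outer sum having only finitely many nonzero terms. -/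
theorem hermite_inner_product_formula
    (d : ℕ) (hd : 1 ≤ d) (s : ℝ) (hs : 0 < s) (p q : MvPolynomial (Fin d) ℂ) :
    Set.Finite {n : ℕ |
      ((s : ℂ) ^ n / (Nat.factorial n : ℂ)) * ∑ k : Fin n → Fin d,
        (starRingEnd ℂ) (MvPolynomial.eval 0 (tupleDeriv d k p)) *
          MvPolynomial.eval 0 (tupleDeriv d k q) ≠ 0} ∧
    ∫ x : Fin d → ℝ,
        (starRingEnd ℂ) (evalR d (heatOp d (-s) p) x) * evalR d (heatOp d (-s) q) x
          ∂(gaussMeasure d s)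
      = ∑' n : ℕ, ((s : ℂ) ^ n / (Nat.factorial n : ℂ)) * ∑ k : Fin n → Fin d,
          (starRingEnd ℂ) (MvPolynomial.eval 0 (tupleDeriv d k p)) *
            MvPolynomial.eval 0 (tupleDeriv d k q) := by
  obtain ⟨N, hN⟩ := exists_derivPairing_eq_zero d p
  refine ⟨(Set.finite_lt_nat N).subset fun n hn => ?_, (hasSum_derivPairing d hs p q).tsum_eq.symm⟩
  by_contra h
  exact hn (mul_eq_zero_of_right _ (hN n (not_lt.1 h) q))
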